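/- arXiv:2412.17841 — 2 statements merged into one kernel-verified Lean document; each statement's English description precedes it below -/
import Mathlib

section
/- Case 6 of the correctness proposition: for every binary vector x ∈ {0,1}^n with x_i = 0 and x_j = 1, setting the ancilla bit to 1 preserves the energy exactly: H_mod(x, 1) = H(x). (No condition on z is needed.) -/
/-- The QUBO energy `H(x) = ∑_{p ≤ q} x_p x_q Q_{p,q}`. -/
def energy {m : ℕ} (A : Matrix (Fin m) (Fin m) ℝ) (x : Fin m → ℝ) : ℝ :=
  ∑ p : Fin m, ∑ q ∈ Finset.Ici p, x p * x q * A p q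

/-- `x` is a binary ({0,1}-valued) vector. -/
def IsBinary {m : ℕ} (x : Fin m → ℝ) : Prop := ∀ p, x p = 0 ∨ x p = 1

/-- The row/column of the ancilla qubit in the enhanced matrix. -/
def ancRow {n : ℕ} (Q : Matrix (Fin n) (Fin n) ℝ) (i j : Fin n) (U : Finset (Fin n)) (z : ℝ)
    (k : Fin n) : ℝ :=
  if k = i ∨ k = j then -2 * z else if k ∈ U then Q i k else 0

/-- The enhanced matrix restricted to the original `n × n` block. -/
def coreMod {n : ℕ} (Q : Matrix (Fin n) (Fin n) ℝ) (i j : Fin n) (U : Finset (Fin n)) (z : ℝ) :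
    Matrix (Fin n) (Fin n) ℝ := fun p q =>
  if p = i ∧ q = i then Q i i + z
  else if p = j ∧ q = j then Q j j + z
  else if (p = i ∧ q = j) ∨ (p = j ∧ q = i) then 2 * z
  else if ((p = i ∨ p = j) ∧ q ∈ U) ∨ (p ∈ U ∧ (q = i ∨ q = j)) then 0
  else Q p q

/-- The enhanced `(n+1) × (n+1)` matrix `Q_mod`, the ancilla being the last index. -/
def QMod {n : ℕ} (Q : Matrix (Fin n) (Fin n) ℝ) (i j : Fin n) (U : Finset (Fin n)) (z : ℝ) :
    Matrix (Fin (n + 1)) (Fin (n + 1)) ℝ := fun p q =>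
  Fin.lastCases
    (Fin.lastCases z (fun k => ancRow Q i j U z k) q)
    (fun p' => Fin.lastCases (ancRow Q i j U z p') (fun q' => coreMod Q i j U z p' q') q)
    p

/-- The modified energy `H_mod(x, b)`: the energy of `x` extended by the ancilla value `b`. -/
noncomputable def energyMod {n : ℕ} (Q : Matrix (Fin n) (Fin n) ℝ) (i j : Fin n)
    (U : Finset (Fin n)) (z : ℝ) (x : Fin n → ℝ) (b : ℝ) : ℝ :=
  energy (QMod Q i j U z) (Fin.snoc x b)

/-- `z = ∑_{p ≤ q} |Q_{p,q}|`, the value of `z` used in the correctness proposition. -/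
def totalWeight {n : ℕ} (Q : Matrix (Fin n) (Fin n) ℝ) : ℝ :=
  ∑ p : Fin n, ∑ q ∈ Finset.Ici p, |Q p q|

theorem energy_eq_sum_ite {m : ℕ} (A : Matrix (Fin m) (Fin m) ℝ) (x : Fin m → ℝ) :
    energy A x = ∑ p, ∑ q, if p ≤ q then x p * x q * A p q else 0 := by
  unfold energy
  refine Finset.sum_congr rfl fun p _ => ?_
  rw [← Finset.sum_filter]
  congr 1
  ext q
  simp

/-- Appending a coordinate to a vector splits its energy into the old energy, the interaction
with the new coordinate, and the new diagonal term. -/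
theorem energy_snoc {n : ℕ} (A : Matrix (Fin (n + 1)) (Fin (n + 1)) ℝ) (x : Fin n → ℝ) (b : ℝ) :
    energy A (Fin.snoc x b : Fin (n + 1) → ℝ) =
      energy (A.submatrix Fin.castSucc Fin.castSucc) x
        + ∑ k, x k * b * A k.castSucc (Fin.last n) + b * b * A (Fin.last n) (Fin.last n) := by
  have h (k : Fin n) : ¬ Fin.last n ≤ k.castSucc := not_le.mpr k.castSucc_lt_last
  rw [energy_eq_sum_ite, energy_eq_sum_ite]
  simp [Fin.sum_univ_castSucc, h, Fin.le_last, Finset.sum_add_distrib, add_assoc]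

/-- The row and column of index `j`, restricted to the upper triangle, together meet every index
exactly once. -/
theorem sum_upper_cross {n : ℕ} (j : Fin n) (c : Fin n → ℝ) :
    (∑ p, ∑ q, if p ≤ q then
      (if p = j then c q else 0) + (if q = j then if p = j then 0 else c p else 0) else 0)
      = ∑ k, c k := by
  have h (p q : Fin n) : (if p ≤ q then
      (if p = j then c q else 0) + (if q = j then if p = j then 0 else c p else 0) else 0)
      = (if p = j then if j ≤ q then c q else 0 else 0)
        + (if q = j then if p < j then c p else 0 else 0) := by
    grind
  simp only [h, Finset.sum_add_distrib, Finset.sum_ite_eq', Finset.mem_univ, if_true]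
  rw [Finset.sum_comm]
  simp only [Finset.sum_ite_eq', Finset.mem_univ, if_true]
  rw [← Finset.sum_add_distrib]
  refine Finset.sum_congr rfl fun k _ => ?_
  grind

theorem case6_xi0_xj1_anc1 {n : ℕ} (Q : Matrix (Fin n) (Fin n) ℝ) (hQ : Q.IsSymm)
    (i j : Fin n) (hij : i ≠ j) (U : Finset (Fin n)) (hiU : i ∉ U) (hjU : j ∉ U)
    (hU : ∀ k ∈ U, Q i k = Q j k) (z : ℝ)
    (x : Fin n → ℝ) (hx : IsBinary x) (hxi : x i = 0) (hxj : x j = 1) :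
    energyMod Q i j U z x 1 = energy Q x := by
  have hs (p q : Fin n) : Q p q = Q q p := hQ.apply q p
  let c : Fin n → ℝ := fun k => if k = j then z else if k ∈ U then -(Q j k * x k) else 0
  have hcore (p q : Fin n) : x p * x q * coreMod Q i j U z p q = x p * x q * Q p q
      + ((if p = j then c q else 0) + (if q = j then if p = j then 0 else c p else 0)) := by
    have hpj := hs p j
    by_cases hpi : p = i
    · subst hpi
      simp [hxi, hij, c, hiU]
    by_cases hqi : q = i
    · subst hqi
      simp [hxi, hij, c, hiU]
    by_cases hp : p = j <;> by_cases hq : q = j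
    · subst hp hq
      simp [coreMod, c, hxj, hpi]
    · subst hp
      by_cases hqU : q ∈ U <;> simp [coreMod, c, hxj, hpi, hqi, hq, hjU, hqU]
      ring
    · subst hq
      by_cases hpU : p ∈ U <;> simp [coreMod, c, hxj, hpi, hqi, hp, hjU, hpU, hpj]
      ring
    · simp [coreMod, hpi, hqi, hp, hq]
  have henergy : energy (coreMod Q i j U z) x = energy Q x + ∑ k, c k := by
    rw [← sum_upper_cross j c, energy_eq_sum_ite, energy_eq_sum_ite]
    simp only [hcore, ← Finset.sum_add_distrib]
    refine Finset.sum_congr rfl fun p _ => Finset.sum_congr rfl fun q _ => ?_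
    split_ifs <;> simp
  have hanc (k : Fin n) : c k + x k * ancRow Q i j U z k = if k = j then -z else 0 := by
    by_cases hkj : k = j
    · subst hkj
      simp [c, ancRow, hxj]
      ring
    by_cases hki : k = i
    · subst hki
      simp [c, hxi, hij, hiU]
    by_cases hkU : k ∈ U
    · simp [c, ancRow, hkj, hki, hkU, hU k hkU]
      ring
    · simp [c, ancRow, hkj, hki, hkU]
  have hsum : ∑ k, c k + ∑ k, x k * ancRow Q i j U z k = -z := by
    rw [← Finset.sum_add_distrib]
    simp [hanc]
  have hsub : (QMod Q i j U z).submatrix Fin.castSucc Fin.castSucc = coreMod Q i j U z := by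
    ext p q
    simp [QMod]
  rw [energyMod, energy_snoc, hsub]
  simp only [QMod, Fin.lastCases_castSucc, Fin.lastCases_last, mul_one, one_mul]
  linarith
end

section
/- Case 7 of the correctness proposition: for every binary vector x ∈ {0,1}^n with x_i = 1 and x_j = 1, setting the ancilla bit to 0 gives H_mod(x, 0) = H(x) + 4z - Q_{i,j} - 2·∑_{k ∈ U, x_k = 1} Q_{i,k}. In particular, if z = ∑_{1 ≤ p ≤ q ≤ n} |Q_{p,q}| and U is nonempty with Q_{i,k} ≠ 0 for all k ∈ U, then H_mod(x, 0) > H(x) strictly. -/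
lemma sum_sum_Ici_eq_ite {m : ℕ} (f : Fin m → Fin m → ℝ) :
    ∑ p, ∑ q ∈ Finset.Ici p, f p q = ∑ p, ∑ q, if p ≤ q then f p q else 0 := by
  refine Finset.sum_congr rfl fun p _ => ?_
  rw [← Finset.sum_filter]
  congr 1
  ext q
  simp

lemma two_mul_sum_sum_Ici {m : ℕ} (f : Fin m → Fin m → ℝ) (hf : ∀ p q, f p q = f q p) :
    2 * ∑ p, ∑ q ∈ Finset.Ici p, f p q = ∑ p, ∑ q, f p q + ∑ p, f p p := by
  have hdiag : ∑ p, f p p = ∑ p, ∑ q, if p = q then f p q else 0 := by simp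
  have hswap : (∑ p, ∑ q, if p ≤ q then f p q else 0)
      = ∑ p, ∑ q, if q ≤ p then f p q else 0 := by
    rw [Finset.sum_comm]
    simp only [hf]
  rw [sum_sum_Ici_eq_ite, two_mul, hdiag]
  conv_lhs => rw [hswap]
  conv_lhs => arg 2; rw [← hswap]
  simp only [← Finset.sum_add_distrib]
  refine Finset.sum_congr rfl fun p _ => Finset.sum_congr rfl fun q _ => ?_
  rcases lt_trichotomy p q with h | h | h
  · simp [h.le, h.not_ge, h.ne]
  · simp [h]
  · simp [h.le, h.not_ge, h.ne']

lemma two_mul_energy {m : ℕ} (A : Matrix (Fin m) (Fin m) ℝ) (hA : ∀ p q, A p q = A q p)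
    (x : Fin m → ℝ) :
    2 * energy A x = ∑ p, ∑ q, x p * x q * A p q + ∑ p, x p * x p * A p p :=
  two_mul_sum_sum_Ici (fun p q => x p * x q * A p q) fun p q => by
    rw [hA p q, mul_comm (x p)]

lemma energyMod_zero {n : ℕ} (Q : Matrix (Fin n) (Fin n) ℝ) (i j : Fin n)
    (U : Finset (Fin n)) (z : ℝ) (x : Fin n → ℝ) :
    energyMod Q i j U z x 0 = energy (coreMod Q i j U z) x := by
  simp only [energyMod, energy, sum_sum_Ici_eq_ite]
  simp [Fin.sum_univ_castSucc, QMod]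

lemma row_sum_abs_le_totalWeight {n : ℕ} (Q : Matrix (Fin n) (Fin n) ℝ)
    (hQ : ∀ p q, Q p q = Q q p) (i : Fin n) : ∑ q, |Q i q| ≤ totalWeight Q := by
  have h2 := two_mul_sum_sum_Ici (fun p q => |Q p q|) fun p q => by rw [hQ p q]
  have hdiag : |Q i i| ≤ ∑ p, |Q p p| :=
    Finset.single_le_sum (f := fun p => |Q p p|) (fun _ _ => abs_nonneg _) (Finset.mem_univ i)
  have hrows : ∑ p, (|Q p i| + if p = i then ∑ q, |Q i q| - |Q i i| else 0)
      ≤ ∑ p, ∑ q, |Q p q| := by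
    refine Finset.sum_le_sum fun p _ => ?_
    split_ifs with h
    · subst h
      simp
    · simpa using Finset.single_le_sum (f := fun q => |Q p q|)
        (fun _ _ => abs_nonneg _) (Finset.mem_univ i)
  have hcol : ∑ p, |Q p i| = ∑ q, |Q i q| := by simp only [hQ _ i]
  rw [Finset.sum_add_distrib, hcol] at hrows
  simp only [Finset.sum_ite_eq', Finset.mem_univ, if_true] at hrows
  simp only [totalWeight]
  linarith

lemma coreMod_apply {n : ℕ} (Q : Matrix (Fin n) (Fin n) ℝ) (hQ : ∀ p q, Q p q = Q q p)
    (i j : Fin n) (hij : i ≠ j) (U : Finset (Fin n)) (hiU : i ∉ U) (hjU : j ∉ U)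
    (hU : ∀ k ∈ U, Q i k = Q j k) (z : ℝ) (p q : Fin n) :
    coreMod Q i j U z p q = Q p q
      + (if p = i then (if q = i then z else 0) + (if q = j then 2 * z - Q i j else 0)
          - (if q ∈ U then Q i q else 0) else 0)
      + (if p = j then (if q = j then z else 0) + (if q = i then 2 * z - Q i j else 0)
          - (if q ∈ U then Q i q else 0) else 0)
      - (if p ∈ U then (if q = i then Q i p else 0) + (if q = j then Q i p else 0) else 0) := by
  unfold coreMod
  grind

lemma energy_coreMod {n : ℕ} (Q : Matrix (Fin n) (Fin n) ℝ) (hQ : ∀ p q, Q p q = Q q p)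
    (i j : Fin n) (hij : i ≠ j) (U : Finset (Fin n)) (hiU : i ∉ U) (hjU : j ∉ U)
    (hU : ∀ k ∈ U, Q i k = Q j k) (z : ℝ) (x : Fin n → ℝ) (hxi : x i = 1) (hxj : x j = 1) :
    energy (coreMod Q i j U z) x
      = energy Q x + 4 * z - Q i j - 2 * ∑ k ∈ U, x k * Q i k := by
  have hsymm : ∀ p q, coreMod Q i j U z p q = coreMod Q i j U z q p := by
    intro p q
    unfold coreMod
    grind
  have h1 := two_mul_energy _ hsymm x
  have h2 := two_mul_energy Q hQ x
  have hdiag : ∑ p, x p * x p * coreMod Q i j U z p p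
      = ∑ p, x p * x p * Q p p + 2 * z := by
    have (p : Fin n) : x p * x p * coreMod Q i j U z p p = x p * x p * Q p p
        + (if p = i then z else 0) + (if p = j then z else 0) := by
      rw [coreMod_apply Q hQ i j hij U hiU hjU hU]
      grind
    simp only [this, Finset.sum_add_distrib, Finset.sum_ite_eq', Finset.mem_univ, if_true]
    ring
  have hfull : ∑ p, ∑ q, x p * x q * coreMod Q i j U z p q
      = ∑ p, ∑ q, x p * x q * Q p q + 6 * z - 2 * Q i j - 4 * ∑ k ∈ U, x k * Q i k := by
    have hrow (c : Prop) [Decidable c] (f : Fin n → ℝ) :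
        (∑ q, if c then f q else 0) = if c then ∑ q, f q else 0 := by
      split_ifs <;> simp
    simp only [coreMod_apply Q hQ i j hij U hiU hjU hU, mul_add, mul_sub, mul_ite, mul_zero,
      Finset.sum_add_distrib, Finset.sum_sub_distrib, hrow, Finset.sum_ite_eq',
      Finset.mem_univ, if_true, Finset.sum_ite_mem, Finset.univ_inter, hxi, hxj, one_mul, mul_one]
    ring
  linarith

theorem case7_xi1_xj1_anc0 {n : ℕ} (Q : Matrix (Fin n) (Fin n) ℝ) (hQ : Q.IsSymm)
    (i j : Fin n) (hij : i ≠ j) (U : Finset (Fin n)) (hiU : i ∉ U) (hjU : j ∉ U)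
    (hU : ∀ k ∈ U, Q i k = Q j k) (z : ℝ)
    (x : Fin n → ℝ) (hx : IsBinary x) (hxi : x i = 1) (hxj : x j = 1) :
    (energyMod Q i j U z x 0
      = energy Q x + 4 * z - Q i j - 2 * ∑ k ∈ U.filter (fun k => x k = 1), Q i k) ∧
    (z = totalWeight Q → U.Nonempty → (∀ k ∈ U, Q i k ≠ 0) →
      energyMod Q i j U z x 0 > energy Q x) := by
  have hsum : ∑ k ∈ U, x k * Q i k = ∑ k ∈ U.filter (fun k => x k = 1), Q i k := by
    rw [Finset.sum_filter]
    refine Finset.sum_congr rfl fun k _ => ?_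
    rcases hx k with h | h <;> simp [h]
  have hQ' (p q : Fin n) : Q p q = Q q p := hQ.apply q p
  have hmain := energy_coreMod Q hQ' i j hij U hiU hjU hU z x hxi hxj
  rw [← energyMod_zero, hsum] at hmain
  refine ⟨hmain, fun hz hne hnz => ?_⟩
  have hrow := row_sum_abs_le_totalWeight Q hQ' i
  have hQij : |Q i j| ≤ ∑ q, |Q i q| :=
    Finset.single_le_sum (f := fun q => |Q i q|) (fun _ _ => abs_nonneg _) (Finset.mem_univ j)
  have hUrow : ∑ k ∈ U, |Q i k| ≤ ∑ q, |Q i q| :=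
    Finset.sum_le_sum_of_subset_of_nonneg (Finset.subset_univ U) fun _ _ _ => abs_nonneg _
  have hpos : 0 < ∑ k ∈ U, |Q i k| := Finset.sum_pos (fun k hk => abs_pos.mpr (hnz k hk)) hne
  have hS : ∑ k ∈ U.filter (fun k => x k = 1), Q i k ≤ ∑ k ∈ U, |Q i k| :=
    (Finset.sum_le_sum fun k _ => le_abs_self (Q i k)).trans
      (Finset.sum_le_sum_of_subset_of_nonneg (Finset.filter_subset _ U)
        fun _ _ _ => abs_nonneg _)
  have := le_abs_self (Q i j)
  linarith
end
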